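/- Let N > 1 be an integer and k > −1 real. Then the series-integral converges absolutely and −(1/(4√π·i))·∫_{(1/N)} e^{Nz}·z^{−k−5/2}·∑_ρ z^{−ρ/2}Γ(ρ/2) dz = −(N^{k+3/2}√π/2)·∑_ρ N^{ρ/2}·Γ(ρ/2)/Γ(k+5/2+ρ/2), where ρ runs over the non-trivial zeros of the Riemann zeta function and ∫_{(1/N)} denotes the integral over the vertical line Re(z) = 1/N. -/

import Mathlib

open Complex

noncomputable section

/-- The second order Taylor remainder of `x ↦ x ^ (1 - s)` on `[n, n + 1]`, at `n = m + 1`. -/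
def zetaRemainder (m : ℕ) (s : ℂ) : ℂ :=
  ((m : ℂ) + 2) ^ (1 - s) - ((m : ℂ) + 1) ^ (1 - s) - (1 - s) * ((m : ℂ) + 1) ^ (-s)

lemma hasDerivAt_ofReal_cpow_pos {x : ℝ} (hx : 0 < x) (r : ℂ) :
    HasDerivAt (fun y : ℝ => (y : ℂ) ^ r) (r * (x : ℂ) ^ (r - 1)) x := by
  have h := (hasDerivAt_id (x : ℂ)).cpow_const (c := r) (Or.inl (by simpa using hx))
  simpa using h.comp_ofReal

lemma norm_zetaRemainder_le (m : ℕ) {s : ℂ} (hs : 0 ≤ s.re) :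
    ‖zetaRemainder m s‖ ≤ ‖s‖ * ‖1 - s‖ * ((m : ℝ) + 1) ^ (-s.re - 1) := by
  set a : ℝ := (m : ℝ) + 1 with ha
  have ha0 : 0 < a := by positivity
  set C : ℝ := ‖s‖ * ‖1 - s‖ * a ^ (-s.re - 1) with hC
  have hC0 : 0 ≤ C := by positivity
  have h1 : ∀ x ∈ Set.Icc a (a + 1),
      ‖(1 - s) * (x : ℂ) ^ (-s) - (1 - s) * (a : ℂ) ^ (-s)‖ ≤ C * (x - a) := by
    refine norm_image_sub_le_of_norm_deriv_le_segment'
      (f := fun x : ℝ => (1 - s) * (x : ℂ) ^ (-s))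
      (f' := fun x : ℝ => (1 - s) * (-s * (x : ℂ) ^ (-s - 1))) ?_ ?_
    · intro x hx
      exact ((hasDerivAt_ofReal_cpow_pos (ha0.trans_le hx.1) (-s)).const_mul _).hasDerivWithinAt
    · intro x hx
      have hx0 : 0 < x := ha0.trans_le hx.1
      rw [norm_mul, norm_mul, norm_neg, norm_cpow_eq_rpow_re_of_pos hx0, hC]
      have : x ^ (-s.re - 1) ≤ a ^ (-s.re - 1) :=
        Real.rpow_le_rpow_of_nonpos ha0 hx.1 (by linarith)
      simp only [sub_re, neg_re, one_re]
      calc ‖1 - s‖ * (‖s‖ * x ^ (-s.re - 1)) = ‖s‖ * ‖1 - s‖ * x ^ (-s.re - 1) := by ring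
        _ ≤ _ := by gcongr
  have h2 := norm_image_sub_le_of_norm_deriv_le_segment'
      (f := fun x : ℝ => (x : ℂ) ^ (1 - s) - x * ((1 - s) * (a : ℂ) ^ (-s))) (a := a) (b := a + 1)
      (f' := fun x : ℝ => (1 - s) * (x : ℂ) ^ (-s) - (1 - s) * (a : ℂ) ^ (-s)) (C := C) ?_ ?_
      (a + 1) ⟨by linarith, le_rfl⟩
  · simp only [add_sub_cancel_left, mul_one] at h2
    refine le_of_eq_of_le ?_ h2
    congr 1
    rw [zetaRemainder, ha]
    push_cast
    ring_nf
  · intro x hx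
    have h := hasDerivAt_ofReal_cpow_pos (ha0.trans_le hx.1) (1 - s)
    have h' := (hasDerivAt_id x).ofReal_comp.mul_const ((1 - s) * (a : ℂ) ^ (-s))
    refine (h.sub h').hasDerivWithinAt.congr_deriv ?_
    rw [show 1 - s - 1 = -s by ring]
    simp
  · intro x hx
    refine (h1 x ⟨hx.1, hx.2.le⟩).trans ?_
    exact mul_le_of_le_one_right hC0 (by linarith [hx.2])

lemma differentiable_zetaRemainder (m : ℕ) : Differentiable ℂ (zetaRemainder m) := by
  have h1 : ((m : ℂ) + 1) ≠ 0 := by exact_mod_cast m.succ_ne_zero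
  have h2 : ((m : ℂ) + 2) ≠ 0 := by exact_mod_cast (m + 1).succ_ne_zero
  intro s
  unfold zetaRemainder
  have e1 : DifferentiableAt ℂ (fun s : ℂ => ((m : ℂ) + 2) ^ (1 - s)) s :=
    DifferentiableAt.const_cpow (by fun_prop) (Or.inl h2)
  have e2 : DifferentiableAt ℂ (fun s : ℂ => ((m : ℂ) + 1) ^ (1 - s)) s :=
    DifferentiableAt.const_cpow (by fun_prop) (Or.inl h1)
  have e3 : DifferentiableAt ℂ (fun s : ℂ => ((m : ℂ) + 1) ^ (-s)) s :=
    DifferentiableAt.const_cpow (by fun_prop) (Or.inl h1)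
  fun_prop

lemma summable_add_one_rpow {c : ℝ} (hc : c < -1) :
    Summable (fun m : ℕ => ((m : ℝ) + 1) ^ c) := by
  have := (summable_nat_add_iff 1).mpr (Real.summable_nat_rpow.mpr hc)
  simpa using this

lemma hasSum_zetaRemainder_of_one_lt_re {s : ℂ} (hs : 1 < s.re) :
    HasSum (fun m => zetaRemainder m s) (riemannZeta₁ s - 1) := by
  have hs1 : s ≠ 1 := by rintro rfl; simp at hs
  have hsum : HasSum (fun n : ℕ => 1 / ((n : ℂ) + 1) ^ s) (riemannZeta s) := by
    rw [zeta_eq_tsum_one_div_nat_add_one_cpow hs]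
    refine Summable.hasSum ?_
    have := (summable_nat_add_iff 1).mpr (Complex.summable_one_div_nat_cpow.mpr hs)
    simpa using this
  have htel : HasSum (fun m : ℕ => ((m : ℂ) + 2) ^ (1 - s) - ((m : ℂ) + 1) ^ (1 - s)) (0 - 1) := by
    have hs' : Summable (fun m : ℕ => ((m : ℂ) + 2) ^ (1 - s) - ((m : ℂ) + 1) ^ (1 - s)) := by
      have h1 : Summable (fun m => zetaRemainder m s) := by
        refine Summable.of_norm_bounded
          (g := fun m : ℕ => ‖s‖ * ‖1 - s‖ * ((m : ℝ) + 1) ^ (-s.re - 1))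
          ((summable_add_one_rpow (by linarith)).mul_left _)
          (fun m => norm_zetaRemainder_le m (by linarith))
      refine (h1.add (hsum.summable.mul_left (1 - s))).congr (fun m => ?_)
      rw [zetaRemainder, cpow_neg, one_div]
      ring
    refine (hs'.hasSum_iff_tendsto_nat).mpr ?_
    have h : ∀ n : ℕ, ∑ m ∈ Finset.range n, (((m : ℂ) + 2) ^ (1 - s) - ((m : ℂ) + 1) ^ (1 - s))
        = ((n : ℂ) + 1) ^ (1 - s) - 1 := by
      intro n
      have := Finset.sum_range_sub (fun m : ℕ => ((m : ℂ) + 1) ^ (1 - s)) n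
      simp only [Nat.cast_add, Nat.cast_one, Nat.cast_zero, zero_add, one_cpow] at this
      rw [← this]
      refine Finset.sum_congr rfl fun m _ => ?_
      ring_nf
    simp_rw [h]
    refine Filter.Tendsto.sub_const ?_ _
    rw [tendsto_zero_iff_norm_tendsto_zero]
    have h3 : ∀ n : ℕ, ‖((n : ℂ) + 1) ^ (1 - s)‖ = ((n : ℝ) + 1) ^ (-(s.re - 1)) := by
      intro n
      have := norm_cpow_eq_rpow_re_of_pos (x := (n : ℝ) + 1) (by positivity) (1 - s)
      push_cast at this
      rw [this]; simp
    simp_rw [h3]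
    exact (tendsto_rpow_neg_atTop (by linarith)).comp
      (Filter.tendsto_atTop_add_const_right _ _ tendsto_natCast_atTop_atTop)
  have := htel.sub (hsum.mul_left (1 - s))
  have e : riemannZeta₁ s - 1 = 0 - 1 - (1 - s) * riemannZeta s := by
    rw [riemannZeta_eq_inv_sub_mul hs1]
    have : s - 1 ≠ 0 := sub_ne_zero.mpr hs1
    field_simp
    ring
  rw [e]
  refine this.congr_fun ?_
  intro m
  rw [zetaRemainder, cpow_neg, one_div]

lemma riemannZeta₁_eq_tsum {s : ℂ} (hs : 1 / 8 < s.re) :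
    riemannZeta₁ s = 1 + ∑' m, zetaRemainder m s := by
  set R : ℝ := ‖s‖ + 3 with hR
  set U : Set ℂ := {z | 1 / 8 < z.re} ∩ Metric.ball 0 R with hU
  have hUo : IsOpen U := (isOpen_lt continuous_const continuous_re).inter Metric.isOpen_ball
  have hUc : IsPreconnected U :=
    ((convex_halfSpace_re_gt _).inter (convex_ball _ _)).isPreconnected
  have hd : DifferentiableOn ℂ (fun z => ∑' m, zetaRemainder m z) U := by
    refine differentiableOn_tsum_of_summable_norm
      (u := fun m : ℕ => R * (1 + R) * ((m : ℝ) + 1) ^ (-9 / 8 : ℝ))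
      ((summable_add_one_rpow (by norm_num)).mul_left _)
      (fun m => (differentiable_zetaRemainder m).differentiableOn) hUo ?_
    intro m z hz
    have hz1 : 1 / 8 < z.re := hz.1
    have hz2 : ‖z‖ < R := by simpa using hz.2
    refine (norm_zetaRemainder_le m (by linarith)).trans ?_
    have h1 : ‖1 - z‖ ≤ 1 + R := (norm_sub_le _ _).trans (by simpa using hz2.le)
    have h2 : ((m : ℝ) + 1) ^ (-z.re - 1) ≤ ((m : ℝ) + 1) ^ (-9 / 8 : ℝ) :=
      Real.rpow_le_rpow_of_exponent_le (by simp) (by linarith)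
    gcongr
  have hf : AnalyticOnNhd ℂ (fun z => 1 + ∑' m, zetaRemainder m z) U :=
    (hd.const_add 1).analyticOnNhd hUo
  have hg : AnalyticOnNhd ℂ riemannZeta₁ U :=
    differentiable_riemannZeta₁.differentiableOn.analyticOnNhd hUo
  refine hg.eqOn_of_preconnected_of_eventuallyEq hf hUc (z₀ := 2) ?_ ?_ ?_
  · refine ⟨by norm_num, ?_⟩
    simp only [Metric.mem_ball, dist_zero_right, hR, norm_ofNat]
    linarith [norm_nonneg s]
  · have : ∀ᶠ z : ℂ in nhds 2, 1 < z.re :=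
      (isOpen_lt continuous_const continuous_re).mem_nhds (by norm_num)
    filter_upwards [this] with z hz
    rw [(hasSum_zetaRemainder_of_one_lt_re hz).tsum_eq]
    ring
  · refine ⟨hs, ?_⟩
    simp only [Metric.mem_ball, dist_zero_right, hR]
    linarith

lemma exists_norm_riemannZeta₁_le : ∃ C : ℝ, 0 ≤ C ∧ ∀ s : ℂ, 1 / 4 ≤ s.re →
    ‖riemannZeta₁ s‖ ≤ 1 + C * (‖s‖ * ‖1 - s‖) := by
  have hsum : Summable (fun m : ℕ => ((m : ℝ) + 1) ^ (-5 / 4 : ℝ)) :=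
    summable_add_one_rpow (by norm_num)
  refine ⟨∑' m : ℕ, ((m : ℝ) + 1) ^ (-5 / 4 : ℝ), tsum_nonneg fun m => by positivity, ?_⟩
  intro s hs
  rw [riemannZeta₁_eq_tsum (by linarith)]
  refine (norm_add_le _ _).trans ?_
  rw [norm_one]
  gcongr
  rw [mul_comm]
  refine tsum_of_norm_bounded (hsum.hasSum.mul_left _) fun m => ?_
  refine (norm_zetaRemainder_le m (by linarith)).trans ?_
  gcongr
  · simp
  · linarith

/-- The non-trivial zeros of the Riemann zeta function. -/
def zetaZeros : Set ℂ := {ρ | riemannZeta ρ = 0 ∧ 0 < ρ.re ∧ ρ.re < 1}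

lemma card_zeros_le_of_norm_le {f : ℂ → ℂ} (hf : Differentiable ℂ f) {c : ℂ} {r R M : ℝ}
    (hr : 0 < r) (hrR : r < R) (hM : 1 ≤ M) (hc : f c ≠ 0)
    (hb : ∀ z ∈ Metric.sphere c R, ‖f z‖ ≤ M) (S : Finset ℂ)
    (hS : ∀ u ∈ S, u ∈ Metric.closedBall c r ∧ f u = 0) :
    (S.card : ℝ) ≤ Real.log (M / ‖f c‖) / Real.log (R / r) := by
  have hR : 0 < R := hr.trans hrR
  have han : ∀ U : Set ℂ, AnalyticOnNhd ℂ f U := fun U z _ => hf.analyticAt z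
  have hJ := AnalyticOnNhd.sum_divisor_le (c := c) (r := r) (R := R) (M := M) (f := f)
    (by rwa [abs_of_pos hr]) (by rwa [abs_of_pos hr, abs_of_pos hR]) hM (han _) hc
    (by rwa [abs_of_pos hR])
  refine le_trans ?_ hJ
  rw [abs_of_pos hr]
  set D := MeromorphicOn.divisor f (Metric.closedBall c r) with hD
  have hfin : D.support.Finite := D.finiteSupport (isCompact_closedBall _ _)
  have hnn : ∀ u, 0 ≤ D u := fun u =>
    MeromorphicOn.AnalyticOnNhd.divisor_nonneg (han _) u
  have hone : ∀ u ∈ S, 1 ≤ D u := by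
    intro u hu
    obtain ⟨hu1, hu2⟩ := hS u hu
    rw [hD, MeromorphicOn.AnalyticOnNhd.divisor_apply (han _) hu1]
    have h0 : analyticOrderAt f u ≠ 0 := by
      rw [(hf.analyticAt u).analyticOrderAt_ne_zero]
      exact hu2
    have htop : analyticOrderAt f u ≠ ⊤ := by
      refine (han Set.univ).analyticOrderAt_ne_top_of_isPreconnected isPreconnected_univ
        (Set.mem_univ c) (Set.mem_univ u) ?_
      rw [(hf.analyticAt c).analyticOrderAt_eq_zero.mpr hc]
      simp
    lift analyticOrderAt f u to ℕ using htop with k hk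
    have : k ≠ 0 := by simpa using h0
    simp only [ENat.map_natCast, WithTop.untop₀_coe]
    omega
  have hsub : S ⊆ hfin.toFinset := by
    intro u hu
    have := hone u hu
    simp only [Set.Finite.mem_toFinset, Function.mem_support]
    omega
  rw [finsum_eq_sum_of_support_subset (s := hfin.toFinset) _ (by simp)]
  have h1 : (S.card : ℤ) ≤ ∑ u ∈ hfin.toFinset, D u := by
    calc (S.card : ℤ) = ∑ u ∈ S, 1 := by simp
      _ ≤ ∑ u ∈ S, D u := Finset.sum_le_sum hone
      _ ≤ _ := Finset.sum_le_sum_of_subset_of_nonneg hsub fun u _ _ => hnn u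
  exact_mod_cast h1

lemma one_third_le_norm_riemannZeta (t : ℝ) : 1 / 3 ≤ ‖riemannZeta (2 + t * I)‖ := by
  have hre : (2 + t * I : ℂ).re = 2 := by simp
  set s : ℂ := 2 + t * I with hs
  have hsum : HasSum (fun n : ℕ => 1 / ((n : ℂ) + 1) ^ s) (riemannZeta s) := by
    rw [zeta_eq_tsum_one_div_nat_add_one_cpow (by rw [hre]; norm_num)]
    refine Summable.hasSum ?_
    have := (summable_nat_add_iff 1).mpr
      (Complex.summable_one_div_nat_cpow (p := s).mpr (by rw [hre]; norm_num))
    simpa using this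
  have h1 := (hasSum_nat_add_iff' 1).mpr hsum
  have h2 : HasSum (fun n : ℕ => 1 / ((n : ℝ) + 2) ^ 2) (Real.pi ^ 2 / 6 - 1) := by
    have := (hasSum_nat_add_iff' 2).mpr hasSum_zeta_two
    simpa [Finset.sum_range_succ] using this
  have h3 : ‖riemannZeta s - 1‖ ≤ Real.pi ^ 2 / 6 - 1 := by
    have h4 := h1.tsum_eq
    simp only [Finset.sum_range_one, Nat.cast_zero, zero_add, one_cpow, div_one] at h4
    rw [← h4]
    refine tsum_of_norm_bounded h2 fun n => le_of_eq ?_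
    have := norm_cpow_eq_rpow_re_of_pos (x := (n : ℝ) + 2) (by positivity) s
    rw [hre] at this
    push_cast at this ⊢
    rw [norm_div, norm_one, add_assoc, one_add_one_eq_two, this]
    norm_cast
  have h5 : ‖(1 : ℂ)‖ ≤ ‖riemannZeta s‖ + ‖riemannZeta s - 1‖ := by
    have := norm_sub_le (riemannZeta s) (riemannZeta s - 1)
    simpa using this
  rw [norm_one] at h5
  have := Real.pi_lt_d4
  have := Real.pi_pos
  nlinarith

lemma riemannZeta₁_eq_zero {ρ : ℂ} (hρ : ρ ∈ zetaZeros) : riemannZeta₁ ρ = 0 := by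
  have h1 : ρ ≠ 1 := by rintro rfl; simpa using hρ.2.2
  have := hρ.1
  rw [riemannZeta_eq_inv_sub_mul h1] at this
  simpa [sub_eq_zero, h1] using this

lemma one_sub_mem_zetaZeros {ρ : ℂ} (hρ : ρ ∈ zetaZeros) : 1 - ρ ∈ zetaZeros := by
  refine ⟨?_, by simpa using hρ.2.2, by simpa using hρ.2.1⟩
  rw [riemannZeta_one_sub, hρ.1, mul_zero]
  · rintro n rfl
    have := hρ.2.1
    simp at this
    linarith [(Nat.cast_nonneg n : (0 : ℝ) ≤ n)]
  · rintro rfl; simpa using hρ.2.2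

lemma exists_card_right_zetaZeros_le {δ : ℝ} (hδ : 0 < δ) : ∃ A : ℝ, 0 ≤ A ∧
    ∀ (n : ℤ) (S : Finset ℂ),
      (∀ ρ ∈ S, ρ ∈ zetaZeros ∧ 1 / 2 ≤ ρ.re ∧ |ρ.im - n| ≤ 1 / 2) →
      (S.card : ℝ) ≤ A * (1 + |(n : ℝ)|) ^ δ := by
  obtain ⟨C, hC, hζ⟩ := exists_norm_riemannZeta₁_le
  have hlog : 0 < Real.log ((7 / 4) / (8 / 5)) := Real.log_pos (by norm_num)
  have hlogD : 0 ≤ Real.log (3 * (1 + 16 * C)) := Real.log_nonneg (by linarith)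
  refine ⟨(Real.log (3 * (1 + 16 * C)) + 2 / δ) / Real.log ((7 / 4) / (8 / 5)), by positivity, ?_⟩
  intro n S hS
  set x : ℝ := 1 + |(n : ℝ)| with hx
  have hx1 : 1 ≤ x := by simp [hx]
  have hx0 : 0 < x := by linarith
  set c : ℂ := 2 + (n : ℝ) * I with hcdef
  have hc1 : c ≠ 1 := by
    intro h
    have := congrArg re h
    simp [hcdef] at this
  have hfc : 1 / 3 ≤ ‖riemannZeta₁ c‖ := by
    have h1 : riemannZeta₁ c = (c - 1) * riemannZeta c := by
      rw [riemannZeta_eq_inv_sub_mul hc1, mul_inv_cancel_left₀ (sub_ne_zero.mpr hc1)]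
    have h2 : 1 ≤ ‖c - 1‖ := by
      refine le_trans ?_ (Complex.re_le_norm _)
      simp [hcdef]; norm_num
    rw [h1, norm_mul]
    nlinarith [one_third_le_norm_riemannZeta n]
  have hcn : ‖c‖ ≤ 2 + |(n : ℝ)| := by
    refine (norm_add_le _ _).trans ?_
    simp
  have hbd : ∀ z ∈ Metric.sphere c (7 / 4), ‖riemannZeta₁ z‖ ≤ (1 + 16 * C) * x ^ 2 := by
    intro z hz
    have hz' : ‖z - c‖ = 7 / 4 := by simpa [dist_eq_norm] using hz
    have hre : 1 / 4 ≤ z.re := by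
      have h1 := (abs_le.mp ((Complex.abs_re_le_norm (z - c)).trans_eq hz')).1
      simp [hcdef] at h1
      linarith
    have hz1 : ‖z‖ ≤ 4 * x := by
      have := norm_add_le (z - c) c
      rw [sub_add_cancel, hz'] at this
      linarith [abs_nonneg (n : ℝ)]
    have hz2 : ‖1 - z‖ ≤ 4 * x := by
      have h1 := norm_sub_le (1 - c) (z - c)
      rw [sub_sub_sub_cancel_right, hz'] at h1
      have h2 : ‖1 - c‖ ≤ 1 + |(n : ℝ)| := by
        have : 1 - c = -1 + -((n : ℝ) * I) := by rw [hcdef]; ring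
        rw [this]
        refine (norm_add_le _ _).trans ?_
        simp
      linarith [abs_nonneg (n : ℝ)]
    refine (hζ z hre).trans ?_
    have h3 : ‖z‖ * ‖1 - z‖ ≤ (4 * x) * (4 * x) := by gcongr
    have h4 : C * (‖z‖ * ‖1 - z‖) ≤ C * ((4 * x) * (4 * x)) := by gcongr
    nlinarith
  have hcard := card_zeros_le_of_norm_le differentiable_riemannZeta₁ (c := c) (r := 8 / 5)
    (R := 7 / 4) (M := (1 + 16 * C) * x ^ 2) (by norm_num) (by norm_num) (by nlinarith)
    (by intro h; rw [h, norm_zero] at hfc; norm_num at hfc) hbd S ?_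
  · refine hcard.trans ?_
    rw [div_mul_eq_mul_div]
    gcongr
    have h1 : Real.log ((1 + 16 * C) * x ^ 2 / ‖riemannZeta₁ c‖)
        ≤ Real.log (3 * (1 + 16 * C) * x ^ 2) := by
      refine Real.log_le_log (by positivity) ?_
      rw [div_le_iff₀ (by linarith)]
      have : 0 ≤ (1 + 16 * C) * x ^ 2 := by positivity
      nlinarith
    have h2 : Real.log (3 * (1 + 16 * C) * x ^ 2)
        = Real.log (3 * (1 + 16 * C)) + 2 * Real.log x := by
      rw [Real.log_mul (by positivity) (by positivity), Real.log_pow]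
      norm_num
    have h3 : Real.log x ≤ x ^ δ / δ := Real.log_le_rpow_div hx0.le hδ
    have h4 : 1 ≤ x ^ δ := Real.one_le_rpow hx1 hδ.le
    calc _ ≤ _ := h1
      _ = _ := h2
      _ ≤ Real.log (3 * (1 + 16 * C)) * x ^ δ + 2 * (x ^ δ / δ) := by
        gcongr
        exact le_mul_of_one_le_right hlogD h4
      _ = _ := by ring
  · intro ρ hρ
    obtain ⟨h1, h2, h3⟩ := hS ρ hρ
    refine ⟨?_, riemannZeta₁_eq_zero h1⟩
    have h4 := h1.2.2
    rw [Metric.mem_closedBall, dist_eq_norm, ← sq_le_sq₀ (norm_nonneg _) (by norm_num),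
      ← Complex.normSq_eq_norm_sq, Complex.normSq_apply]
    have e1 : (ρ - c).re = ρ.re - 2 := by simp [hcdef]
    have e2 : (ρ - c).im = ρ.im - n := by simp [hcdef]
    rw [e1, e2]
    have h5 := abs_le.mp h3
    nlinarith

lemma exists_card_zetaZeros_le {δ : ℝ} (hδ : 0 < δ) : ∃ A : ℝ, 0 ≤ A ∧
    ∀ (n : ℤ) (S : Finset ℂ), (∀ ρ ∈ S, ρ ∈ zetaZeros ∧ |ρ.im - n| ≤ 1 / 2) →
      (S.card : ℝ) ≤ A * (1 + |(n : ℝ)|) ^ δ := by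
  obtain ⟨A, hA, h⟩ := exists_card_right_zetaZeros_le hδ
  refine ⟨2 * A, by positivity, fun n S hS => ?_⟩
  classical
  have h1 := h n (S.filter fun ρ => 1 / 2 ≤ ρ.re) (by
    intro ρ hρ
    rw [Finset.mem_filter] at hρ
    exact ⟨(hS ρ hρ.1).1, hρ.2, (hS ρ hρ.1).2⟩)
  have h2 := h (-n) ((S.filter fun ρ => ¬ 1 / 2 ≤ ρ.re).image fun ρ => 1 - ρ) (by
    intro ρ' hρ'
    rw [Finset.mem_image] at hρ'
    obtain ⟨ρ, hρ, rfl⟩ := hρ'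
    rw [Finset.mem_filter] at hρ
    refine ⟨one_sub_mem_zetaZeros (hS ρ hρ.1).1, ?_, ?_⟩
    · simp only [sub_re, one_re]
      linarith [not_le.mp hρ.2]
    · have := (hS ρ hρ.1).2
      simp only [sub_im, one_im, Int.cast_neg]
      rw [← abs_neg]
      convert this using 2
      ring)
  rw [Finset.card_image_of_injective _ (fun a b hab => by simpa using hab)] at h2
  simp only [Int.cast_neg, abs_neg] at h2
  have h3 := Finset.card_filter_add_card_filter_not (s := S) (fun ρ : ℂ => 1 / 2 ≤ ρ.re)
  have h4 : (S.card : ℝ) = ((S.filter fun ρ => 1 / 2 ≤ ρ.re).card : ℝ)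
      + ((S.filter fun ρ => ¬ 1 / 2 ≤ ρ.re).card : ℝ) := by exact_mod_cast h3.symm
  linarith

lemma summable_zetaZeros_rpow {ε : ℝ} (hε : 0 < ε) :
    Summable (fun ρ : zetaZeros => (1 + |(ρ : ℂ).im|) ^ (-1 - ε)) := by
  obtain ⟨A, hA, hcard⟩ := exists_card_zetaZeros_le (half_pos hε)
  set g : zetaZeros → ℝ := fun ρ => (1 + |(ρ : ℂ).im|) ^ (-1 - ε) with hg
  have hg0 : ∀ ρ, 0 ≤ g ρ := fun ρ => by positivity
  set B : ℤ → ℝ := fun n => A * 2 ^ (1 + ε) * (1 + |(n : ℝ)|) ^ (-1 - ε / 2) with hB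
  have hfib : ∀ (n : ℤ) (u : Finset {ρ : zetaZeros // round (ρ : ℂ).im = n}),
      ∑ y ∈ u, g y ≤ B n := by
    intro n u
    set x : ℝ := 1 + |(n : ℝ)| with hx
    have hx0 : 0 < x := by positivity
    have hround : ∀ y : {ρ : zetaZeros // round (ρ : ℂ).im = n}, |(y : ℂ).im - n| ≤ 1 / 2 := by
      intro y
      have := abs_sub_round ((y : ℂ).im)
      rwa [y.2] at this
    have h1 : ∀ y ∈ u, g y ≤ 2 ^ (1 + ε) * x ^ (-1 - ε) := by
      intro y _
      have h2 : x / 2 ≤ 1 + |(y : ℂ).im| := by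
        have h3 := hround y
        have h4 := abs_sub_abs_le_abs_sub (n : ℝ) ((y : ℂ).im)
        rw [abs_sub_comm] at h4
        linarith [abs_nonneg (n : ℝ), abs_nonneg (y : ℂ).im]
      calc g y ≤ (x / 2) ^ (-1 - ε) :=
            Real.rpow_le_rpow_of_nonpos (by positivity) h2 (by linarith)
        _ = _ := by
          rw [Real.div_rpow hx0.le (by norm_num), show (1 + ε) = -(-1 - ε) by ring,
            Real.rpow_neg (by norm_num)]
          field_simp
    have h2 : (u.card : ℝ) ≤ A * x ^ (ε / 2) := by
      have hinj : Function.Injective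
          (fun y : {ρ : zetaZeros // round (ρ : ℂ).im = n} => ((y : zetaZeros) : ℂ)) :=
        Subtype.val_injective.comp Subtype.val_injective
      have := hcard n (u.map ⟨_, hinj⟩) (by
        intro ρ hρ
        rw [Finset.mem_map] at hρ
        obtain ⟨y, _, rfl⟩ := hρ
        exact ⟨y.1.2, hround y⟩)
      rwa [Finset.card_map] at this
    calc ∑ y ∈ u, g y ≤ u.card • (2 ^ (1 + ε) * x ^ (-1 - ε)) := Finset.sum_le_card_nsmul _ _ _ h1
      _ ≤ (A * x ^ (ε / 2)) * (2 ^ (1 + ε) * x ^ (-1 - ε)) := by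
        rw [nsmul_eq_mul]
        gcongr
      _ = A * 2 ^ (1 + ε) * (x ^ (ε / 2) * x ^ (-1 - ε)) := by ring
      _ = B n := by
        rw [← Real.rpow_add hx0, hB]
        congr 2
        ring
  have hBs : Summable B := by
    refine Summable.mul_left _ ?_
    have h : Summable (fun n : ℕ => (1 + |((n : ℤ) : ℝ)|) ^ (-1 - ε / 2)) := by
      refine (summable_add_one_rpow (c := -1 - ε / 2) (by linarith)).congr fun n => ?_
      rw [Int.cast_natCast, Nat.abs_cast, add_comm]
    exact Summable.of_nat_of_neg h (by simpa using h)
  rw [← (Equiv.sigmaFiberEquiv (fun ρ : zetaZeros => round (ρ : ℂ).im)).summable_iff]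
  refine (summable_sigma_of_nonneg fun _ => hg0 _).mpr
    ⟨fun n => summable_of_sum_le (fun _ => hg0 _) (hfib n), ?_⟩
  exact Summable.of_nonneg_of_le (fun n => tsum_nonneg fun _ => hg0 _)
    (fun n => Real.tsum_le_of_sum_le (fun _ => hg0 _) (hfib n)) hBs

lemma norm_Gamma_one_half_add_le (t : ℝ) :
    ‖Gamma (1 / 2 + t * I)‖ ≤ Real.sqrt (2 * Real.pi) * Real.exp (-(Real.pi * |t| / 2)) := by
  have h := Complex.Gamma_mul_Gamma_one_sub (1 / 2 + t * I)
  have hc : (1 - (1 / 2 + t * I) : ℂ) = (starRingEnd ℂ) (1 / 2 + t * I) := by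
    simp only [map_add, map_mul, conj_I, conj_ofReal, map_div₀, map_one, map_ofNat]
    ring
  rw [hc, Gamma_conj, mul_conj, normSq_eq_norm_sq] at h
  have hs : Complex.sin (Real.pi * (1 / 2 + t * I)) = (Real.cosh (Real.pi * t) : ℝ) := by
    rw [show (Real.pi * (1 / 2 + t * I) : ℂ) = (Real.pi * t : ℂ) * I + Real.pi / 2 by ring,
      Complex.sin_add_pi_div_two, Complex.cos_mul_I]
    push_cast
    rfl
  rw [hs] at h
  have h' : ‖Gamma (1 / 2 + t * I)‖ ^ 2 = Real.pi / Real.cosh (Real.pi * t) := by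
    exact_mod_cast h
  refine (sq_le_sq₀ (norm_nonneg _) (by positivity)).mp ?_
  rw [h', mul_pow, Real.sq_sqrt (by positivity), ← Real.exp_nat_mul, div_le_iff₀ (Real.cosh_pos _)]
  have hcosh : Real.exp (Real.pi * |t|) / 2 ≤ Real.cosh (Real.pi * t) := by
    rw [← Real.cosh_abs, abs_mul, abs_of_pos Real.pi_pos, Real.cosh_eq]
    linarith [Real.exp_pos (-(Real.pi * |t|))]
  calc Real.pi = 2 * Real.pi * Real.exp ((2 : ℕ) * -(Real.pi * |t| / 2)) *
        (Real.exp (Real.pi * |t|) / 2) := by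
        have : Real.exp ((2 : ℕ) * -(Real.pi * |t| / 2)) * Real.exp (Real.pi * |t|) = 1 := by
          rw [← Real.exp_add, Real.exp_eq_one_iff]; push_cast; ring
        linear_combination (-Real.pi) * this
    _ ≤ _ := by gcongr

lemma norm_Gamma_le_Gamma_re {s : ℂ} (hs : 0 < s.re) : ‖Gamma s‖ ≤ Real.Gamma s.re := by
  rw [Complex.Gamma_eq_integral hs, Real.Gamma_eq_integral hs, Complex.GammaIntegral]
  refine (MeasureTheory.norm_integral_le_integral_norm _).trans_eq ?_
  refine MeasureTheory.setIntegral_congr_fun measurableSet_Ioi fun x hx => ?_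
  have hx : 0 < x := hx
  simp [norm_cpow_eq_rpow_re_of_pos hx, norm_exp]

/-- `Γ(s)` divided by its Stirling approximation in the upper half plane, up to constants. -/
def stirlingQuotient (s : ℂ) : ℂ :=
  Gamma s * exp (-(I * (Real.pi / 2 * s))) * (-(I * s)) ^ (1 / 2 - s)

lemma norm_stirlingQuotient {s : ℂ} (hs : s ≠ 0) :
    ‖stirlingQuotient s‖ = ‖Gamma s‖ * Real.exp (Real.pi * s.im / 2) *
      (‖s‖ ^ (1 / 2 - s.re) * Real.exp (s.im * arg (-(I * s)))) := by
  rw [stirlingQuotient, norm_mul, norm_mul, norm_exp, norm_cpow_of_ne_zero (by simpa using hs)]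
  have : ((1 / 2 : ℂ)).re = 1 / 2 ∧ ((1 / 2 : ℂ)).im = 0 := by norm_num
  congr 1
  · congr 2
    simp
    ring
  · simp only [sub_re, sub_im, this, zero_sub, mul_neg, Real.exp_neg, div_inv_eq_mul, norm_neg,
      norm_mul, norm_I, one_mul]
    rw [mul_comm s.im]

lemma norm_stirlingQuotient_le {s : ℂ} (hs : 0 < s.re) :
    ‖stirlingQuotient s‖ ≤
      ‖Gamma s‖ * Real.exp (Real.pi * |s.im| / 2) * ‖s‖ ^ (1 / 2 - s.re) := by
  have hs0 : s ≠ 0 := by rintro rfl; simp at hs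
  have him : (-(I * s)).im = -s.re := by simp
  have harg0 : arg (-(I * s)) < 0 := by rw [arg_neg_iff, him]; linarith
  have hargpi := neg_pi_lt_arg (-(I * s))
  rw [norm_stirlingQuotient hs0]
  have key : Real.pi * s.im / 2 + s.im * arg (-(I * s)) ≤ Real.pi * |s.im| / 2 := by
    rcases le_total 0 s.im with h | h
    · rw [abs_of_nonneg h]; nlinarith
    · rw [abs_of_nonpos h]; nlinarith
  calc _ = ‖Gamma s‖ * Real.exp (Real.pi * s.im / 2 + s.im * arg (-(I * s))) *
        ‖s‖ ^ (1 / 2 - s.re) := by rw [Real.exp_add]; ring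
    _ ≤ _ := by gcongr

lemma norm_stirlingQuotient_le_of_re_mem {s : ℂ} (h1 : 1 / 2 ≤ s.re) (h2 : s.re ≤ 3 / 2) :
    ‖stirlingQuotient s‖ ≤ Real.sqrt (2 * Real.pi) := by
  have hbd : ∀ t : ℝ, ‖Gamma (1 / 2 + t * I)‖ * Real.exp (Real.pi * |t| / 2) ≤
      Real.sqrt (2 * Real.pi) := by
    intro t
    refine (mul_le_mul_of_nonneg_right (norm_Gamma_one_half_add_le t) (by positivity)).trans_eq ?_
    rw [mul_assoc, ← Real.exp_add]; simp
  refine PhragmenLindelof.vertical_strip (a := 1 / 2) (b := 3 / 2) (f := stirlingQuotient)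
    ?_ ?_ ?_ ?_ h1 h2
  · have hcl : closure (re ⁻¹' Set.Ioo (1 / 2 : ℝ) (3 / 2)) ⊆ {z : ℂ | 0 < z.re} := by
      refine (closure_minimal (t := re ⁻¹' Set.Icc (1 / 2 : ℝ) (3 / 2))
        (Set.preimage_mono Set.Ioo_subset_Icc_self) (isClosed_Icc.preimage continuous_re)).trans ?_
      intro z hz
      have : 1 / 2 ≤ z.re := hz.1
      show 0 < z.re
      linarith
    refine DifferentiableOn.diffContOnCl (DifferentiableOn.mono ?_ hcl)
    intro z (hz : 0 < z.re)
    refine DifferentiableAt.differentiableWithinAt ?_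
    have hg : DifferentiableAt ℂ Gamma z := by
      refine differentiableAt_Gamma _ fun m hm => ?_
      rw [hm] at hz
      simp at hz
      linarith [Nat.cast_nonneg (α := ℝ) m]
    have : -(I * z) ∈ slitPlane := by
      rw [mem_slitPlane_iff]; right; simp; linarith
    unfold stirlingQuotient
    refine (hg.mul (by fun_prop)).mul ?_
    exact DifferentiableAt.cpow (by fun_prop) (by fun_prop) this
  · obtain ⟨M, hM⟩ := isCompact_Icc.bddAbove_image
      (f := Real.Gamma) (K := Set.Icc (1 / 2 : ℝ) (3 / 2)) (by
        intro x hx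
        refine (Real.differentiableAt_Gamma fun m hm => ?_).continuousAt.continuousWithinAt
        have := hx.1
        linarith [Nat.cast_nonneg (α := ℝ) m])
    refine ⟨2, by have := Real.pi_gt_three; norm_num; linarith, 1, ?_⟩
    refine Asymptotics.IsBigO.of_bound (M * 2) ?_
    refine Filter.Eventually.filter_mono inf_le_right ?_
    refine Filter.eventually_principal.mpr fun z hz => ?_
    have hz1 : 1 / 2 < z.re := hz.1
    have hz2 : z.re < 3 / 2 := hz.2
    refine (norm_stirlingQuotient_le (by linarith)).trans ?_
    have hG : ‖Gamma z‖ ≤ M := (norm_Gamma_le_Gamma_re (by linarith)).trans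
      (hM ⟨z.re, ⟨hz1.le, hz2.le⟩, rfl⟩)
    have hn : 1 / 2 ≤ ‖z‖ := hz1.le.trans ((le_abs_self _).trans (abs_re_le_norm z))
    have hp : ‖z‖ ^ (1 / 2 - z.re) ≤ 2 := by
      calc ‖z‖ ^ (1 / 2 - z.re) ≤ (1 / 2 : ℝ) ^ (1 / 2 - z.re) :=
            Real.rpow_le_rpow_of_nonpos (by norm_num) hn (by linarith)
        _ ≤ (1 / 2 : ℝ) ^ (-1 : ℝ) :=
            Real.rpow_le_rpow_of_exponent_ge (by norm_num) (by norm_num) (by linarith)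
        _ = 2 := by rw [Real.rpow_neg_one]; norm_num
    have hM0 : 0 ≤ M := (norm_nonneg _).trans hG
    have he : Real.exp (Real.pi * |z.im| / 2) ≤ ‖Real.exp (1 * Real.exp (2 * |z.im|))‖ := by
      rw [Real.norm_of_nonneg (Real.exp_pos _).le]
      gcongr
      have := Real.add_one_le_exp (2 * |z.im|)
      have := Real.pi_lt_four
      nlinarith [abs_nonneg z.im]
    calc _ ≤ M * ‖Real.exp (1 * Real.exp (2 * |z.im|))‖ * 2 := by gcongr
      _ = _ := by ring
  · intro z hz
    refine (norm_stirlingQuotient_le (by rw [hz]; norm_num)).trans ?_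
    rw [hz, sub_self, Real.rpow_zero, mul_one]
    have := hbd z.im
    rwa [show (1 / 2 + z.im * I : ℂ) = z by apply Complex.ext <;> simp [hz]] at this
  · intro z hz
    have hz' : z = (1 / 2 + z.im * I : ℂ) + 1 := by
      apply Complex.ext <;> simp [hz]
      norm_num
    have hne : (1 / 2 + z.im * I : ℂ) ≠ 0 := by
      intro h
      have := congrArg re h
      simp at this
    have hle : ‖(1 / 2 + z.im * I : ℂ)‖ ≤ ‖z‖ := by
      rw [← sq_le_sq₀ (norm_nonneg _) (norm_nonneg _), ← normSq_eq_norm_sq, ← normSq_eq_norm_sq,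
        normSq_apply, normSq_apply, hz]
      simp
      norm_num
    have hzpos : 0 < ‖z‖ := (norm_pos_iff.mpr hne).trans_le hle
    refine (norm_stirlingQuotient_le (by rw [hz]; norm_num)).trans ?_
    have hG : ‖Gamma z‖ = ‖(1 / 2 + z.im * I : ℂ)‖ * ‖Gamma (1 / 2 + z.im * I)‖ := by
      conv_lhs => rw [hz', Gamma_add_one _ hne, norm_mul]
    rw [hz, hG, show (1 / 2 - 3 / 2 : ℝ) = -1 by norm_num, Real.rpow_neg_one]
    calc _ = (‖Gamma (1 / 2 + z.im * I)‖ * Real.exp (Real.pi * |z.im| / 2)) *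
          (‖(1 / 2 + z.im * I : ℂ)‖ * ‖z‖⁻¹) := by ring
      _ ≤ Real.sqrt (2 * Real.pi) * 1 := by
          gcongr
          · exact hbd _
          · rw [← div_eq_mul_inv, div_le_one hzpos]; exact hle
      _ = _ := mul_one _

lemma neg_im_mul_arg_le {s : ℂ} (hs : 0 < s.re) (ht : 0 < s.im) :
    -(s.im * arg (-(I * s))) ≤ s.re := by
  have hre : (-(I * s)).re = s.im := by simp
  have him : (-(I * s)).im = -s.re := by simp
  have harg0 : arg (-(I * s)) < 0 := by rw [arg_neg_iff, him]; linarith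
  have h2 : |arg (-(I * s))| < Real.pi / 2 :=
    abs_arg_lt_pi_div_two_iff.mpr (Or.inl (by rw [hre]; exact ht))
  rw [abs_of_neg harg0] at h2
  have := Real.le_tan (neg_nonneg.mpr harg0.le) h2
  rw [Real.tan_neg, tan_arg, hre, him, neg_div, neg_neg, le_div_iff₀ ht] at this
  linarith

lemma norm_Gamma_le_of_re_mem {s : ℂ} (h1 : 1 / 2 ≤ s.re) (h2 : s.re ≤ 3 / 2) (ht : 0 < s.im) :
    ‖Gamma s‖ ≤ Real.sqrt (2 * Real.pi) * Real.exp (3 / 2) * ‖s‖ ^ (s.re - 1 / 2) *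
      Real.exp (-(Real.pi * s.im / 2)) := by
  have hs : 0 < s.re := by linarith
  have hs0 : s ≠ 0 := by rintro rfl; simp at hs
  have hpos : 0 < ‖s‖ := norm_pos_iff.mpr hs0
  have h := norm_stirlingQuotient_le_of_re_mem h1 h2
  rw [norm_stirlingQuotient hs0] at h
  have harg := neg_im_mul_arg_le hs ht
  calc ‖Gamma s‖ = (‖Gamma s‖ * Real.exp (Real.pi * s.im / 2) *
      (‖s‖ ^ (1 / 2 - s.re) * Real.exp (s.im * arg (-(I * s))))) *
      (Real.exp (-(s.im * arg (-(I * s)))) * ‖s‖ ^ (s.re - 1 / 2) *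
        Real.exp (-(Real.pi * s.im / 2))) := by
        have e1 : Real.exp (Real.pi * s.im / 2) * Real.exp (-(Real.pi * s.im / 2)) = 1 := by
          rw [← Real.exp_add, add_neg_cancel, Real.exp_zero]
        have e2 : Real.exp (s.im * arg (-(I * s))) * Real.exp (-(s.im * arg (-(I * s)))) = 1 := by
          rw [← Real.exp_add, add_neg_cancel, Real.exp_zero]
        have e3 : ‖s‖ ^ (1 / 2 - s.re) * ‖s‖ ^ (s.re - 1 / 2) = 1 := by
          rw [← Real.rpow_add hpos]; simp
        calc ‖Gamma s‖ = ‖Gamma s‖ * (Real.exp (Real.pi * s.im / 2) *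
              Real.exp (-(Real.pi * s.im / 2))) * (Real.exp (s.im * arg (-(I * s))) *
              Real.exp (-(s.im * arg (-(I * s))))) *
              (‖s‖ ^ (1 / 2 - s.re) * ‖s‖ ^ (s.re - 1 / 2)) := by rw [e1, e2, e3]; ring
          _ = _ := by ring
    _ ≤ Real.sqrt (2 * Real.pi) * (Real.exp (3 / 2) * ‖s‖ ^ (s.re - 1 / 2) *
        Real.exp (-(Real.pi * s.im / 2))) := by
        gcongr
        linarith
    _ = _ := by ring

/-- Stirling-type upper bound for `Γ` on the strip `0 < re s < 1 / 2`. -/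
lemma exists_norm_Gamma_le : ∃ C : ℝ, 0 < C ∧ ∀ s : ℂ, 0 < s.re → s.re < 1 / 2 → 1 / 2 ≤ |s.im| →
    ‖Gamma s‖ ≤ C * |s.im| ^ (s.re - 1 / 2) * Real.exp (-(Real.pi * |s.im| / 2)) := by
  set A := Real.sqrt (2 * Real.pi) * Real.exp (3 / 2) with hA
  have hA0 : 0 < A := by positivity
  have main : ∀ s : ℂ, 0 < s.re → s.re < 1 / 2 → 1 / 2 ≤ s.im →
      ‖Gamma s‖ ≤ 4 * A * s.im ^ (s.re - 1 / 2) * Real.exp (-(Real.pi * s.im / 2)) := by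
    intro s h0 h1 h2
    have hs0 : s ≠ 0 := by rintro rfl; simp at h0
    have him : 0 < s.im := by linarith
    have hh : s.re + 1 ≤ 3 / 2 := by linarith
    have h := norm_Gamma_le_of_re_mem (s := s + 1) (by simp; linarith) (by simpa using hh)
      (by simpa using him)
    rw [Gamma_add_one _ hs0, norm_mul, ← hA] at h
    simp only [add_re, one_re, add_im, one_im, add_zero] at h
    have hle : s.im ≤ ‖s‖ := (le_abs_self _).trans (abs_im_le_norm s)
    have hub : ‖s + 1‖ ≤ 4 * s.im := by
      refine (norm_le_abs_re_add_abs_im _).trans ?_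
      simp only [add_re, one_re, add_im, one_im, add_zero]
      rw [abs_of_pos him, abs_of_pos (by linarith)]
      linarith
    have hp : ‖s + 1‖ ^ (s.re + 1 - 1 / 2) ≤ 4 * s.im ^ (s.re - 1 / 2) * s.im := by
      calc _ ≤ (4 * s.im) ^ (s.re + 1 - 1 / 2) :=
            Real.rpow_le_rpow (norm_nonneg _) hub (by linarith)
        _ = 4 ^ (s.re + 1 - 1 / 2) * s.im ^ (s.re + 1 - 1 / 2) :=
            Real.mul_rpow (by norm_num) him.le
        _ ≤ 4 ^ (1 : ℝ) * s.im ^ (s.re + 1 - 1 / 2) := by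
            gcongr
            · norm_num
            · linarith
        _ = _ := by
            rw [Real.rpow_one, show s.re + 1 - 1 / 2 = (s.re - 1 / 2) + 1 by ring,
              Real.rpow_add_one him.ne']
            ring
    refine le_of_mul_le_mul_left ?_ him
    calc s.im * ‖Gamma s‖ ≤ ‖s‖ * ‖Gamma s‖ := by gcongr
      _ ≤ _ := h
      _ ≤ A * (4 * s.im ^ (s.re - 1 / 2) * s.im) * Real.exp (-(Real.pi * s.im / 2)) := by gcongr
      _ = _ := by ring
  refine ⟨4 * A, by positivity, fun s h0 h1 h2 => ?_⟩
  rcases le_total 0 s.im with h | h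
  · rw [abs_of_nonneg h] at h2 ⊢
    exact main s h0 h1 h2
  · rw [abs_of_nonpos h] at h2 ⊢
    have := main ((starRingEnd ℂ) s) (by rwa [conj_re]) (by rwa [conj_re])
      (by rwa [conj_im])
    rwa [Gamma_conj, norm_conj, conj_re, conj_im] at this

lemma integrableOn_cpow_mul_exp_neg_mul_Ioi {s r : ℂ} (hs : 0 < s.re) (hr : 0 < r.re) :
    MeasureTheory.IntegrableOn (fun t : ℝ => (t : ℂ) ^ (s - 1) * exp (-(r * t))) (Set.Ioi 0) := by
  have h := integrableOn_rpow_mul_exp_neg_mul_rpow (s := s.re - 1) (p := 1) (b := r.re)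
    (by linarith) zero_lt_one hr
  refine MeasureTheory.Integrable.mono' h ?_ ?_
  · refine ContinuousOn.aestronglyMeasurable ?_ measurableSet_Ioi
    refine ContinuousOn.mul ?_ (by fun_prop)
    intro t ht
    exact (hasDerivAt_ofReal_cpow_pos ht _).continuousAt.continuousWithinAt
  · refine (MeasureTheory.ae_restrict_iff' measurableSet_Ioi).mpr (.of_forall fun t ht => ?_)
    have ht : 0 < t := ht
    rw [norm_mul, norm_cpow_eq_rpow_re_of_pos ht, norm_exp]
    simp

lemma differentiableAt_integral_cpow_mul_exp_neg_mul {s r : ℂ} (hs : 0 < s.re) (hr : 0 < r.re) :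
    DifferentiableAt ℂ
      (fun r : ℂ => ∫ t : ℝ in Set.Ioi 0, (t : ℂ) ^ (s - 1) * exp (-(r * t))) r := by
  have hopen : {z : ℂ | r.re / 2 < z.re} ∈ nhds r :=
    (isOpen_lt continuous_const continuous_re).mem_nhds (by simpa using hr)
  have hpos : ∀ z ∈ {z : ℂ | r.re / 2 < z.re}, 0 < z.re := fun z hz =>
    (half_pos hr).trans hz
  refine (hasDerivAt_integral_of_dominated_loc_of_deriv_le
    (μ := MeasureTheory.volume.restrict (Set.Ioi (0 : ℝ)))
    (F' := fun r t => (t : ℂ) ^ (s - 1) * (exp (-(r * t)) * -(t : ℂ)))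
    (bound := fun t => t ^ s.re * Real.exp (-(r.re / 2) * t ^ (1 : ℝ)))
    hopen ?_ ?_ ?_ ?_ ?_ ?_).2.differentiableAt
  · filter_upwards [hopen] with z hz
    exact (integrableOn_cpow_mul_exp_neg_mul_Ioi hs (hpos z hz)).aestronglyMeasurable
  · exact integrableOn_cpow_mul_exp_neg_mul_Ioi hs hr
  · refine ContinuousOn.aestronglyMeasurable ?_ measurableSet_Ioi
    refine ContinuousOn.mul ?_ (by fun_prop)
    intro t ht
    exact (hasDerivAt_ofReal_cpow_pos ht _).continuousAt.continuousWithinAt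
  · refine (MeasureTheory.ae_restrict_iff' measurableSet_Ioi).mpr (.of_forall fun t ht z hz => ?_)
    have ht : 0 < t := ht
    have hz : r.re / 2 < z.re := hz
    rw [norm_mul, norm_mul, norm_cpow_eq_rpow_re_of_pos ht, norm_exp, norm_neg, norm_real,
      Real.norm_of_nonneg ht.le, Real.rpow_one]
    calc _ = (t ^ (s.re - 1) * t) * Real.exp (-(z.re * t)) := by simp; ring
      _ = t ^ s.re * Real.exp (-(z.re * t)) := by
          rw [← Real.rpow_add_one ht.ne', sub_add_cancel]
      _ ≤ _ := by gcongr; nlinarith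
  · exact integrableOn_rpow_mul_exp_neg_mul_rpow (by linarith) zero_lt_one (by linarith)
  · refine .of_forall fun t z _ => ?_
    have : HasDerivAt (fun z : ℂ => -(z * t)) (-(t : ℂ)) z := by
      simpa using ((hasDerivAt_id z).mul_const (t : ℂ)).fun_neg
    exact this.cexp.const_mul _

lemma integral_cpow_mul_exp_neg_mul_Ioi_of_re_pos {s r : ℂ} (hs : 0 < s.re) (hr : 0 < r.re) :
    ∫ t : ℝ in Set.Ioi 0, (t : ℂ) ^ (s - 1) * exp (-(r * t)) = Gamma s * r ^ (-s) := by
  have hopen : IsOpen {z : ℂ | 0 < z.re} := isOpen_lt continuous_const continuous_re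
  have hF : AnalyticOnNhd ℂ
      (fun r : ℂ => ∫ t : ℝ in Set.Ioi 0, (t : ℂ) ^ (s - 1) * exp (-(r * t))) {z | 0 < z.re} :=
    DifferentiableOn.analyticOnNhd (fun z hz =>
      (differentiableAt_integral_cpow_mul_exp_neg_mul hs hz).differentiableWithinAt) hopen
  have hG : AnalyticOnNhd ℂ (fun r : ℂ => Gamma s * r ^ (-s)) {z | 0 < z.re} :=
    DifferentiableOn.analyticOnNhd (fun z hz =>
      ((differentiableAt_id.cpow_const (Or.inl hz)).const_mul _).differentiableWithinAt) hopen
  refine hF.eqOn_of_preconnected_of_frequently_eq hG (convex_halfSpace_re_gt 0).isPreconnected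
    (z₀ := 1) (by simp) ?_ hr
  have ht : Filter.Tendsto (fun x : ℝ => (x : ℂ)) (nhdsWithin 1 {1}ᶜ) (nhdsWithin 1 {1}ᶜ) := by
    refine tendsto_nhdsWithin_iff.mpr ⟨?_, ?_⟩
    · have := (continuous_ofReal.tendsto 1).mono_left (nhdsWithin_le_nhds (s := {1}ᶜ))
      simpa using this
    · filter_upwards [self_mem_nhdsWithin] with x hx
      simpa using hx
  refine ht.frequently (Filter.Eventually.frequently ?_)
  filter_upwards [nhdsWithin_le_nhds (lt_mem_nhds (zero_lt_one (α := ℝ)))] with x hx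
  rw [Complex.integral_cpow_mul_exp_neg_mul_Ioi hs hx, mul_comm, one_div, inv_cpow, cpow_neg]
  rw [arg_ofReal_of_nonneg hx.le]
  exact Real.pi_pos.ne

lemma abs_arg_le_pi_div_two_sub {z : ℂ} (hz : 0 < z.re) :
    |arg z| ≤ Real.pi / 2 - z.re / ‖z‖ := by
  have hz0 : z ≠ 0 := by rintro rfl; simp at hz
  have h1 : |arg z| ≤ Real.pi / 2 := abs_arg_le_pi_div_two_iff.mpr hz.le
  have h2 := Real.sin_le (sub_nonneg.mpr h1)
  rw [Real.sin_pi_div_two_sub, Real.cos_abs, cos_arg hz0] at h2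
  linarith

lemma norm_cpow_neg_le_of_re_pos {z : ℂ} (hz : 0 < z.re) (s : ℂ) :
    ‖z ^ (-s)‖ ≤ ‖z‖ ^ (-s.re) * Real.exp ((Real.pi / 2 - z.re / ‖z‖) * |s.im|) := by
  have hz0 : z ≠ 0 := by rintro rfl; simp at hz
  rw [norm_cpow_of_ne_zero hz0, div_eq_mul_inv, ← Real.exp_neg, neg_re, neg_im]
  gcongr
  calc -(arg z * -s.im) ≤ |arg z * s.im| := by rw [mul_neg, neg_neg]; exact le_abs_self _
    _ = |arg z| * |s.im| := abs_mul _ _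
    _ ≤ _ := by gcongr; exact abs_arg_le_pi_div_two_sub hz

lemma norm_cpow_neg_le_exp_of_re_pos {z : ℂ} (hz : 0 < z.re) (s : ℂ) :
    ‖z ^ (-s)‖ ≤ ‖z‖ ^ (-s.re) * Real.exp (Real.pi / 2 * |s.im|) := by
  refine (norm_cpow_neg_le_of_re_pos hz s).trans ?_
  gcongr
  exact sub_le_self _ (by positivity)

lemma integrable_norm_add_mul_I_rpow_neg {a p : ℝ} (ha : 0 < a) (hp : 1 < p) :
    MeasureTheory.Integrable (fun y : ℝ => ‖(a : ℂ) + y * I‖ ^ (-p)) := by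
  have h := (integrable_rpow_neg_one_add_norm_sq (E := ℝ) (μ := MeasureTheory.volume) (r := p)
    (by simpa using hp)).comp_div ha.ne'
  refine (h.const_mul (a ^ (-p))).congr (.of_forall fun y => ?_)
  have h1 : ‖(a : ℂ) + y * I‖ = (a ^ 2 * (1 + ‖y / a‖ ^ 2)) ^ (1 / 2 : ℝ) := by
    rw [← Real.sqrt_eq_rpow, norm_add_mul_I, Real.norm_eq_abs, sq_abs]
    congr 1
    field_simp
  simp only
  rw [h1, ← Real.rpow_mul (by positivity), Real.mul_rpow (by positivity) (by positivity),
    ← Real.rpow_natCast a 2, ← Real.rpow_mul ha.le]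
  congr 2 <;> (push_cast; ring)

/-- Laplace inversion of `Γ(s) r ^ (-s)` on a vertical line. -/
lemma integral_exp_mul_cpow_neg_vertical {a x : ℝ} (ha : 0 < a) (hx : 0 < x) {s : ℂ}
    (hs : 1 < s.re) :
    ∫ y : ℝ, exp (x * (a + y * I)) * ((a : ℂ) + y * I) ^ (-s) =
      2 * Real.pi * (x : ℂ) ^ (s - 1) / Gamma s := by
  have hs0 : 0 < s.re := by linarith
  set f : ℝ → ℂ := (Set.Ioi (0 : ℝ)).indicator fun t => (t : ℂ) ^ (s - 1) * exp (-(a * t)) with hf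
  have hfi : MeasureTheory.Integrable f := (MeasureTheory.integrable_indicator_iff
    measurableSet_Ioi).mpr (integrableOn_cpow_mul_exp_neg_mul_Ioi hs0 (by simpa using ha))
  have hfour : ∀ w : ℝ, FourierTransform.fourier f w =
      Gamma s * ((a : ℂ) + (2 * Real.pi * w : ℝ) * I) ^ (-s) := by
    intro w
    rw [← integral_cpow_mul_exp_neg_mul_Ioi_of_re_pos hs0 (by simpa using ha),
      Real.fourier_real_eq_integral_exp_smul, ← MeasureTheory.integral_indicator measurableSet_Ioi]
    congr 1
    ext t
    by_cases ht : t ∈ Set.Ioi (0 : ℝ)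
    · simp only [hf, Set.indicator_of_mem ht, smul_eq_mul]
      rw [mul_left_comm, ← exp_add]
      congr 2
      push_cast
      ring
    · simp only [hf, Set.indicator_of_notMem ht, smul_zero]
  have hgi : MeasureTheory.Integrable (fun y : ℝ => Gamma s * ((a : ℂ) + y * I) ^ (-s)) := by
    refine MeasureTheory.Integrable.const_mul ?_ _
    refine ((integrable_norm_add_mul_I_rpow_neg ha hs).mul_const
      (Real.exp (Real.pi / 2 * |s.im|))).mono' ?_ (.of_forall fun y => ?_)
    · refine Continuous.aestronglyMeasurable ?_
      refine Continuous.cpow (by fun_prop) continuous_const fun y => ?_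
      exact Or.inl (by simpa using ha)
    · exact norm_cpow_neg_le_exp_of_re_pos (by simpa using ha) s
  have hpi : (2 * Real.pi : ℝ) ≠ 0 := (mul_pos two_pos Real.pi_pos).ne'
  have hFi : MeasureTheory.Integrable (FourierTransform.fourier f) := by
    rw [funext hfour]
    exact hgi.comp_mul_left' hpi
  have hcont : ContinuousAt f x := by
    have : ContinuousAt (fun t : ℝ => (t : ℂ) ^ (s - 1) * exp (-(a * t))) x :=
      (hasDerivAt_ofReal_cpow_pos hx _).continuousAt.mul (by fun_prop)
    refine this.congr ?_
    filter_upwards [lt_mem_nhds hx] with t ht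
    rw [hf, Set.indicator_of_mem (Set.mem_Ioi.mpr ht)]
  have hinv := hfi.fourierInv_fourier_eq hFi hcont
  rw [Real.fourierInv_eq', funext hfour, hf, Set.indicator_of_mem (s := Set.Ioi (0 : ℝ)) hx] at hinv
  have hcv := MeasureTheory.Measure.integral_comp_mul_left
    (fun y : ℝ => exp (x * y * I) * (Gamma s * ((a : ℂ) + y * I) ^ (-s))) (2 * Real.pi)
  have hG : Gamma s ≠ 0 := Gamma_ne_zero_of_re_pos hs0
  have hL : ∫ w : ℝ, exp ((2 * Real.pi * inner ℝ w x : ℝ) * I) •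
      (Gamma s * ((a : ℂ) + (2 * Real.pi * w : ℝ) * I) ^ (-s)) =
      ∫ w : ℝ, exp (x * (2 * Real.pi * w : ℝ) * I) *
        (Gamma s * ((a : ℂ) + (2 * Real.pi * w : ℝ) * I) ^ (-s)) := by
    congr 1
    ext w
    rw [smul_eq_mul]
    congr 3
    simp
    ring
  rw [hL, hcv, abs_of_pos (inv_pos.mpr (by positivity : (0 : ℝ) < 2 * Real.pi)), real_smul] at hinv
  have hE : ∫ y : ℝ, exp (x * (a + y * I)) * ((a : ℂ) + y * I) ^ (-s) =
      (exp (x * a) / Gamma s) *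
        ∫ y : ℝ, exp (x * y * I) * (Gamma s * ((a : ℂ) + y * I) ^ (-s)) := by
    rw [← MeasureTheory.integral_const_mul]
    congr 1
    ext y
    rw [show (x * (a + y * I) : ℂ) = x * a + x * y * I by ring, exp_add]
    field_simp
  have hexp : exp (x * a) * exp (-(a * x)) = 1 := by
    rw [← exp_add, mul_comm (x : ℂ), add_neg_cancel, exp_zero]
  rw [hE]
  set J := ∫ y : ℝ, exp (x * y * I) * (Gamma s * ((a : ℂ) + y * I) ^ (-s))
  have hJ : J = 2 * Real.pi * ((x : ℂ) ^ (s - 1) * exp (-(a * x))) := by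
    rw [← hinv]
    push_cast
    have : (Real.pi : ℂ) ≠ 0 := by exact_mod_cast Real.pi_pos.ne'
    field_simp
  rw [hJ]
  linear_combination (2 * Real.pi * (x : ℂ) ^ (s - 1) / Gamma s) * hexp

lemma exp_neg_le_rpow_neg {u q : ℝ} {n : ℕ} (hu : 0 < u) (hq : 0 ≤ q) (hqn : q ≤ n) :
    Real.exp (-u) ≤ n.factorial * Real.exp 1 * u ^ (-q) := by
  have h1 : u ^ q ≤ n.factorial * Real.exp 1 * Real.exp u := by
    calc u ^ q ≤ (max 1 u) ^ q := Real.rpow_le_rpow hu.le (le_max_right _ _) hq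
      _ ≤ (max 1 u) ^ (n : ℝ) := Real.rpow_le_rpow_of_exponent_le (le_max_left _ _) hqn
      _ = (max 1 u) ^ n := Real.rpow_natCast _ _
      _ ≤ n.factorial * Real.exp (max 1 u) := by
          have := Real.pow_div_factorial_le_exp (max 1 u) (by positivity) n
          rwa [div_le_iff₀' (by positivity)] at this
      _ ≤ n.factorial * Real.exp (1 + u) := by
          gcongr
          exact max_le (by linarith) (by linarith)
      _ = _ := by rw [Real.exp_add]; ring
  rw [Real.rpow_neg hu.le, Real.exp_neg, ← div_eq_mul_inv, inv_eq_one_div,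
    div_le_div_iff₀ (Real.exp_pos _) (by positivity), one_mul]
  exact h1

/-- Uniform bound for the general term of the series on the line `re z = a`. -/
lemma exists_norm_cpow_mul_Gamma_le {a k : ℝ} (ha : 0 < a) (ha2 : a ≤ 2) (hk : -1 < k) :
    ∃ K : ℝ, 0 < K ∧ ∀ ρ z : ℂ, 0 < ρ.re → ρ.re < 1 → 1 ≤ |ρ.im| → z.re = a →
      ‖Gamma (ρ / 2) * z ^ (-(k + 5 / 2 + ρ / 2))‖ ≤
        K * |ρ.im| ^ (-1 - (k + 1) / 2) * ‖z‖ ^ (-(1 + (k + 1) / 2)) := by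
  obtain ⟨C, hC0, hC⟩ := exists_norm_Gamma_le
  obtain ⟨n, hn⟩ := exists_nat_ge (k / 2 + 3 / 2)
  refine ⟨C * 2 * (n.factorial * Real.exp 1 * (a / 2) ^ (-(k / 2 + 3 / 2))), by positivity,
    fun ρ z h0 h1 hc hz => ?_⟩
  set c := |ρ.im| with hcdef
  have hc0 : 0 < c := by linarith
  have hzre : 0 < z.re := by rw [hz]; exact ha
  have hz0 : 0 < ‖z‖ := hzre.trans_le ((le_abs_self _).trans (abs_re_le_norm z))
  have hre : (ρ / 2).re = ρ.re / 2 := by simp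
  have him : (ρ / 2).im = ρ.im / 2 := by simp
  have habs : |(ρ / 2).im| = c / 2 := by rw [him, abs_div, abs_two]
  have hG := hC (ρ / 2) (by rw [hre]; linarith) (by rw [hre]; linarith) (by rw [habs]; linarith)
  rw [habs, hre] at hG
  have hsre : ((k : ℂ) + 5 / 2 + ρ / 2).re = k + 5 / 2 + ρ.re / 2 := by
    simp
  have hsim : |((k : ℂ) + 5 / 2 + ρ / 2).im| = c / 2 := by
    rw [← habs]; simp
  have hZ := norm_cpow_neg_le_of_re_pos hzre (k + 5 / 2 + ρ / 2)
  rw [hsre, hsim, hz] at hZ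
  set q := k / 2 + 1 + ρ.re / 2 with hq
  have hu : 0 < a / 2 * (c / ‖z‖) := by positivity
  have hexp := exp_neg_le_rpow_neg (q := q) hu (by linarith) (n := n) (by linarith)
  rw [Real.mul_rpow (by positivity) (by positivity), Real.div_rpow hc0.le hz0.le,
    Real.rpow_neg hz0.le q, div_inv_eq_mul] at hexp
  have ha' : (a / 2) ^ (-q) ≤ (a / 2) ^ (-(k / 2 + 3 / 2)) :=
    Real.rpow_le_rpow_of_exponent_ge (by positivity) (by linarith) (by linarith)
  have h2 : (c / 2) ^ (ρ.re / 2 - 1 / 2) ≤ 2 * c ^ (ρ.re / 2 - 1 / 2) := by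
    rw [div_eq_mul_inv, Real.mul_rpow hc0.le (by norm_num), mul_comm, Real.inv_rpow (by norm_num),
      ← Real.rpow_neg (by norm_num)]
    gcongr
    calc (2 : ℝ) ^ (-(ρ.re / 2 - 1 / 2)) ≤ 2 ^ (1 : ℝ) :=
          Real.rpow_le_rpow_of_exponent_le (by norm_num) (by linarith)
      _ = 2 := Real.rpow_one _
  rw [norm_mul]
  calc ‖Gamma (ρ / 2)‖ * ‖z ^ (-(k + 5 / 2 + ρ / 2) : ℂ)‖
      ≤ (C * (c / 2) ^ (ρ.re / 2 - 1 / 2) * Real.exp (-(Real.pi * (c / 2) / 2))) *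
        (‖z‖ ^ (-(k + 5 / 2 + ρ.re / 2)) *
          Real.exp ((Real.pi / 2 - a / ‖z‖) * (c / 2))) := by gcongr
    _ = C * (c / 2) ^ (ρ.re / 2 - 1 / 2) * ‖z‖ ^ (-(k + 5 / 2 + ρ.re / 2)) *
        Real.exp (-(a / 2 * (c / ‖z‖))) := by
        rw [show -(a / 2 * (c / ‖z‖)) = -(Real.pi * (c / 2) / 2) +
          (Real.pi / 2 - a / ‖z‖) * (c / 2) by ring, Real.exp_add]
        ring
    _ ≤ C * (2 * c ^ (ρ.re / 2 - 1 / 2)) * ‖z‖ ^ (-(k + 5 / 2 + ρ.re / 2)) *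
        (n.factorial * Real.exp 1 * ((a / 2) ^ (-(k / 2 + 3 / 2)) * (c ^ (-q) * ‖z‖ ^ q))) := by
        gcongr
        exact hexp.trans (by gcongr)
    _ = C * 2 * (n.factorial * Real.exp 1 * (a / 2) ^ (-(k / 2 + 3 / 2))) *
        (c ^ (ρ.re / 2 - 1 / 2) * c ^ (-q)) *
        (‖z‖ ^ (-(k + 5 / 2 + ρ.re / 2)) * ‖z‖ ^ q) := by ring
    _ = _ := by
        rw [← Real.rpow_add hc0, ← Real.rpow_add hz0]
        congr 2
        · congr 1; rw [hq]; ring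
        · rw [hq]; ring

lemma cpow_mul_cpow_eq_cpow_neg {z : ℂ} (hz : z ≠ 0) (k : ℝ) (ρ : ℂ) :
    z ^ (-(k : ℂ) - 5 / 2) * z ^ (-ρ / 2) = z ^ (-(k + 5 / 2 + ρ / 2)) := by
  rw [← cpow_add _ _ hz]
  congr 1
  ring

lemma integrable_exp_mul_cpow_neg_vertical {a : ℝ} (ha : 0 < a) (x : ℝ) {s : ℂ} (hs : 1 < s.re) :
    MeasureTheory.Integrable
      (fun y : ℝ => exp (x * (a + y * I)) * ((a : ℂ) + y * I) ^ (-s)) := by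
  refine (((integrable_norm_add_mul_I_rpow_neg ha hs).mul_const
    (Real.exp (Real.pi / 2 * |s.im|))).const_mul (Real.exp (x * a))).mono' ?_
    (.of_forall fun y => ?_)
  · refine Continuous.aestronglyMeasurable (.mul (by fun_prop) ?_)
    refine Continuous.cpow (by fun_prop) continuous_const fun y => ?_
    exact Or.inl (by simpa using ha)
  · rw [norm_mul, norm_exp, show ((x : ℂ) * (a + y * I)).re = x * a by simp]
    gcongr
    exact norm_cpow_neg_le_exp_of_re_pos (by simpa using ha) s

lemma eventually_one_lt_abs_im_zetaZeros :
    ∀ᶠ ρ : zetaZeros in Filter.cofinite, 1 < |(ρ : ℂ).im| := by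
  have h := (summable_zetaZeros_rpow one_pos).tendsto_cofinite_zero
  filter_upwards [h.eventually_lt_const (show (0 : ℝ) < 2 ^ (-1 - 1 : ℝ) by positivity)] with ρ hρ
  rw [Real.rpow_lt_rpow_iff_of_neg (by positivity) (by norm_num) (by norm_num)] at hρ
  linarith

instance : Countable zetaZeros := by
  have h := (summable_zetaZeros_rpow one_pos).countable_support
  refine Set.countable_univ_iff.mp (h.mono fun ρ _ => ?_)
  exact ne_of_gt (Real.rpow_pos_of_pos (by positivity) _)

/-- The series of integrals over `re z = a` converges absolutely. -/
lemma summable_integral_norm_zetaZeros {a k : ℝ} (ha : 0 < a) (ha2 : a ≤ 2) (hk : -1 < k) (x : ℝ) :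
    Summable (fun ρ : zetaZeros => ∫ y : ℝ, ‖Gamma ((ρ : ℂ) / 2) *
      (exp (x * (a + y * I)) * ((a : ℂ) + y * I) ^ (-(k + 5 / 2 + (ρ : ℂ) / 2)))‖) := by
  obtain ⟨K, hK0, hK⟩ := exists_norm_cpow_mul_Gamma_le ha ha2 hk
  have h_integral := integrable_norm_add_mul_I_rpow_neg ha
    (show 1 < 1 + (k + 1) / 2 by linarith)
  set J := ∫ y : ℝ, ‖(a : ℂ) + y * I‖ ^ (-(1 + (k + 1) / 2)) with hJ
  have hJ0 : 0 ≤ J := MeasureTheory.integral_nonneg fun y => by positivity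
  have hsum := (summable_zetaZeros_rpow (ε := (k + 1) / 2) (by linarith)).mul_left
    (Real.exp (x * a) * K * J * 2 ^ (1 + (k + 1) / 2))
  refine hsum.of_norm_bounded_eventually ?_
  filter_upwards [eventually_one_lt_abs_im_zetaZeros] with ρ hρ
  have hc0 : 0 < |(ρ : ℂ).im| := by linarith
  rw [Real.norm_of_nonneg (MeasureTheory.integral_nonneg fun y => norm_nonneg _)]
  have hc : |(ρ : ℂ).im| ^ (-1 - (k + 1) / 2) ≤
      2 ^ (1 + (k + 1) / 2) * (1 + |(ρ : ℂ).im|) ^ (-1 - (k + 1) / 2) := by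
    calc |(ρ : ℂ).im| ^ (-1 - (k + 1) / 2) ≤ ((1 + |(ρ : ℂ).im|) / 2) ^ (-1 - (k + 1) / 2) :=
          Real.rpow_le_rpow_of_nonpos (by positivity) (by linarith) (by linarith)
      _ = _ := by
          rw [Real.div_rpow (by positivity) (by norm_num), div_eq_mul_inv, mul_comm,
            ← Real.rpow_neg (by norm_num)]
          congr 2
          ring
  calc _ ≤ ∫ y : ℝ, Real.exp (x * a) * K * |(ρ : ℂ).im| ^ (-1 - (k + 1) / 2) *
        ‖(a : ℂ) + y * I‖ ^ (-(1 + (k + 1) / 2)) := by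
        refine MeasureTheory.integral_mono_of_nonneg (.of_forall fun y => norm_nonneg _)
          (h_integral.const_mul _) (.of_forall fun y => ?_)
        have := hK ρ (a + y * I) ρ.2.2.1 ρ.2.2.2 hρ.le (by simp)
        simp only
        rw [mul_left_comm, norm_mul, norm_exp, show ((x : ℂ) * (a + y * I)).re = x * a by simp]
        refine (mul_le_mul_of_nonneg_left this (Real.exp_pos _).le).trans_eq (by ring)
    _ = Real.exp (x * a) * K * |(ρ : ℂ).im| ^ (-1 - (k + 1) / 2) * J :=
        MeasureTheory.integral_const_mul _ _
    _ ≤ Real.exp (x * a) * K *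
        (2 ^ (1 + (k + 1) / 2) * (1 + |(ρ : ℂ).im|) ^ (-1 - (k + 1) / 2)) * J := by gcongr
    _ = _ := by ring

/-- Evaluation of `I₃`: absolute convergence and
`-(1/(4√π i)) ∫_{(1/N)} e^{Nz} z^{-k-5/2} ∑_ρ z^{-ρ/2} Γ(ρ/2) dz
  = -(N^{k+3/2} √π / 2) ∑_ρ N^{ρ/2} Γ(ρ/2)/Γ(k+5/2+ρ/2)`. -/
theorem I3_evaluation (N : ℕ) (hN : 1 < N) (k : ℝ) (hk : -1 < k) :
    Summable (fun ρ : zetaZeros =>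
      ∫ y : ℝ,
        ‖Complex.exp ((N : ℂ) * ((1 / (N : ℂ)) + y * Complex.I)) *
            ((1 / (N : ℂ)) + y * Complex.I) ^ (-(k : ℂ) - 5 / 2) *
              ((1 / (N : ℂ)) + y * Complex.I) ^ (-(ρ : ℂ) / 2) *
                Complex.Gamma ((ρ : ℂ) / 2)‖) ∧
    -(1 / (4 * (Real.sqrt Real.pi : ℂ) * Complex.I)) *
        (∫ y : ℝ,
          Complex.exp ((N : ℂ) * ((1 / (N : ℂ)) + y * Complex.I)) *
            ((1 / (N : ℂ)) + y * Complex.I) ^ (-(k : ℂ) - 5 / 2) *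
              (∑' ρ : zetaZeros,
                ((1 / (N : ℂ)) + y * Complex.I) ^ (-(ρ : ℂ) / 2) *
                  Complex.Gamma ((ρ : ℂ) / 2)) *
                Complex.I)
      = -((N : ℂ) ^ ((k : ℂ) + 3 / 2) * (Real.sqrt Real.pi : ℂ) / 2 *
          ∑' ρ : zetaZeros,
            (N : ℂ) ^ ((ρ : ℂ) / 2) * Complex.Gamma ((ρ : ℂ) / 2) /
              Complex.Gamma ((k : ℂ) + 5 / 2 + (ρ : ℂ) / 2)) := by
  have hN0 : (0 : ℝ) < N := by exact_mod_cast (zero_lt_one.trans hN)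
  have ha : (0 : ℝ) < 1 / N := by positivity
  have ha2 : (1 / N : ℝ) ≤ 2 := by
    rw [div_le_iff₀ hN0]
    have : (1 : ℝ) < N := by exact_mod_cast hN
    linarith
  have hcast : 1 / (N : ℂ) = ((1 / N : ℝ) : ℂ) := by push_cast; rfl
  have hcastN : (N : ℂ) = ((N : ℝ) : ℂ) := by push_cast; rfl
  simp only [hcast]
  rw [hcastN]
  set a : ℝ := 1 / N
  set x : ℝ := (N : ℝ)
  have hz : ∀ y : ℝ, (a : ℂ) + y * I ≠ 0 := fun y h => by
    have := congrArg re h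
    simp [ha.ne'] at this
  have hterm : ∀ (ρ : zetaZeros) (y : ℝ), exp (x * (a + y * I)) *
      ((a : ℂ) + y * I) ^ (-(k : ℂ) - 5 / 2) * ((a : ℂ) + y * I) ^ (-(ρ : ℂ) / 2) *
        Gamma ((ρ : ℂ) / 2) = Gamma ((ρ : ℂ) / 2) *
      (exp (x * (a + y * I)) * ((a : ℂ) + y * I) ^ (-(k + 5 / 2 + (ρ : ℂ) / 2))) := by
    intro ρ y
    rw [← cpow_mul_cpow_eq_cpow_neg (hz y)]
    ring
  have hs : ∀ ρ : zetaZeros, 1 < ((k : ℂ) + 5 / 2 + (ρ : ℂ) / 2).re := by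
    intro ρ
    have h1 := ρ.2.2.1
    have : ((k : ℂ) + 5 / 2 + (ρ : ℂ) / 2).re = k + 5 / 2 + (ρ : ℂ).re / 2 := by simp
    rw [this]
    linarith
  have hsum := summable_integral_norm_zetaZeros ha ha2 hk x
  refine ⟨by simpa only [hterm] using hsum, ?_⟩
  have hswap := MeasureTheory.hasSum_integral_of_summable_integral_norm
    (fun ρ : zetaZeros => (integrable_exp_mul_cpow_neg_vertical ha x (hs ρ)).const_mul
      (Gamma ((ρ : ℂ) / 2))) hsum
  have hx0 : (x : ℂ) ≠ 0 := by exact_mod_cast hN0.ne'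
  have h_integral : ∀ ρ : zetaZeros, ∫ y : ℝ, Gamma ((ρ : ℂ) / 2) *
      (exp (x * (a + y * I)) * ((a : ℂ) + y * I) ^ (-(k + 5 / 2 + (ρ : ℂ) / 2))) =
      2 * Real.pi * (x : ℂ) ^ ((k : ℂ) + 3 / 2) * ((x : ℂ) ^ ((ρ : ℂ) / 2) *
        Gamma ((ρ : ℂ) / 2) / Gamma ((k : ℂ) + 5 / 2 + (ρ : ℂ) / 2)) := by
    intro ρ
    rw [MeasureTheory.integral_const_mul, integral_exp_mul_cpow_neg_vertical ha hN0 (hs ρ),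
      show (k : ℂ) + 5 / 2 + (ρ : ℂ) / 2 - 1 = (k + 3 / 2) + (ρ : ℂ) / 2 by ring,
      cpow_add _ _ hx0]
    ring
  have hfun : ∀ y : ℝ, exp (x * (a + y * I)) * ((a : ℂ) + y * I) ^ (-(k : ℂ) - 5 / 2) *
      (∑' ρ : zetaZeros, ((a : ℂ) + y * I) ^ (-(ρ : ℂ) / 2) * Gamma ((ρ : ℂ) / 2)) * I =
      (∑' ρ : zetaZeros, Gamma ((ρ : ℂ) / 2) *
        (exp (x * (a + y * I)) * ((a : ℂ) + y * I) ^ (-(k + 5 / 2 + (ρ : ℂ) / 2)))) * I := by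
    intro y
    rw [← tsum_mul_left]
    congr 2
    ext ρ
    rw [← hterm, mul_assoc _ (_ ^ _) (Gamma _)]
  have hpi : (Real.pi : ℂ) = (Real.sqrt Real.pi : ℂ) * (Real.sqrt Real.pi : ℂ) := by
    rw [← ofReal_mul, Real.mul_self_sqrt Real.pi_pos.le]
  have hsq : (Real.sqrt Real.pi : ℂ) ≠ 0 := by
    exact_mod_cast (Real.sqrt_pos.mpr Real.pi_pos).ne'
  simp only [hfun]
  rw [MeasureTheory.integral_mul_const, ← hswap.tsum_eq]
  simp only [h_integral]
  rw [tsum_mul_left, hpi]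
  field_simp
  norm_num

end
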